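/- arXiv:1106.3175 — 3 statements merged into one kernel-verified Lean document; each statement's English description precedes it below -/
import Mathlib

section
/- For the canal surface C, at every point (s,t) where (EG − F²)(s,t) ≠ 0, the mean curvature satisfies H(s,t) = (−Q²/(2r·(EG − F²)))·{ 2κ²(Q² + R²)cos²(t) + κ(4(Q′R − QR′) + 3Q)cos(t) + (R′)² + (Q′)² − 2R′ − RR″ − QQ″ + 1 }, where all functions R, Q, κ, r are evaluated at s. -/
open scoped RealInnerProductSpace

section OrthonormalTriple

variable {V : Type*} [NormedAddCommGroup V] [InnerProductSpace ℝ V]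

theorem inner_orthonormal_triple_combination {T N B : V}
    (hT1 : ‖T‖ = 1) (hN1 : ‖N‖ = 1) (hB1 : ‖B‖ = 1)
    (hTN : ⟪T, N⟫ = 0) (hTB : ⟪T, B⟫ = 0) (hNB : ⟪N, B⟫ = 0)
    (x y z x' y' z' : ℝ) :
    ⟪x • T + y • N + z • B, x' • T + y' • N + z' • B⟫ = x * x' + y * y' + z * z' := by
  have hNT : ⟪N, T⟫ = 0 := by rw [real_inner_comm]; exact hTN
  have hBT : ⟪B, T⟫ = 0 := by rw [real_inner_comm]; exact hTB
  have hBN : ⟪B, N⟫ = 0 := by rw [real_inner_comm]; exact hNB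
  simp only [inner_add_left, inner_add_right, real_inner_smul_left, real_inner_smul_right,
    real_inner_self_eq_norm_sq, hT1, hN1, hB1, hTN, hTB, hNB, hNT, hBT, hBN]
  ring

theorem HasDerivAt.frenet_combination {T N B : ℝ → V} {x y z : ℝ → ℝ}
    {κ τ x' y' z' s : ℝ}
    (hT : HasDerivAt T (κ • N s) s) (hN : HasDerivAt N ((-κ) • T s + τ • B s) s)
    (hB : HasDerivAt B ((-τ) • N s) s)
    (hx : HasDerivAt x x' s) (hy : HasDerivAt y y' s) (hz : HasDerivAt z z' s) :
    HasDerivAt (fun u => x u • T u + y u • N u + z u • B u)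
      ((x' - κ * y s) • T s + (y' + κ * x s - τ * z s) • N s + (z' + τ * y s) • B s) s := by
  refine (((hx.smul hT).add (hy.smul hN)).add (hz.smul hB)).congr_deriv ?_
  module

theorem HasDerivAt.triple_combination_const {x y z : ℝ → ℝ} {x' y' z' t : ℝ} (T N B : V)
    (hx : HasDerivAt x x' t) (hy : HasDerivAt y y' t) (hz : HasDerivAt z z' t) :
    HasDerivAt (fun u => x u • T + y u • N + z u • B) (x' • T + y' • N + z' • B) t :=
  ((hx.smul_const T).add (hy.smul_const N)).add (hz.smul_const B)

end OrthonormalTriple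

theorem canal_mean_curvature
    (α T N B : ℝ → EuclideanSpace ℝ (Fin 3)) (κ τ r : ℝ → ℝ)
    (hα : ContDiff ℝ (⊤ : ℕ∞) α) (hT : ContDiff ℝ (⊤ : ℕ∞) T)
    (hN : ContDiff ℝ (⊤ : ℕ∞) N) (hB : ContDiff ℝ (⊤ : ℕ∞) B)
    (hκ : ContDiff ℝ (⊤ : ℕ∞) κ) (hτ : ContDiff ℝ (⊤ : ℕ∞) τ)
    (hr : ContDiff ℝ (⊤ : ℕ∞) r)
    (hTα : ∀ s, T s = deriv α s)
    (hT1 : ∀ s, ‖T s‖ = 1) (hN1 : ∀ s, ‖N s‖ = 1) (hB1 : ∀ s, ‖B s‖ = 1)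
    (hTN : ∀ s, ⟪T s, N s⟫ = 0) (hTB : ∀ s, ⟪T s, B s⟫ = 0)
    (hNB : ∀ s, ⟪N s, B s⟫ = 0)
    (hT' : ∀ s, deriv T s = κ s • N s)
    (hN' : ∀ s, deriv N s = (-κ s) • T s + τ s • B s)
    (hB' : ∀ s, deriv B s = (-τ s) • N s)
    (hrpos : ∀ s, 0 < r s) (hr1 : ∀ s, |deriv r s| < 1)
    (R Q : ℝ → ℝ)
    (hR : ∀ s, R s = r s * deriv r s)
    (hQ : ∀ s, Q s = r s * Real.sqrt (1 - (deriv r s) ^ 2))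
    (C : ℝ → ℝ → EuclideanSpace ℝ (Fin 3))
    (hC : ∀ s t, C s t = α s - R s • T s - (Q s * Real.cos t) • N s
      + (Q s * Real.sin t) • B s)
    (Cs Ct : ℝ → ℝ → EuclideanSpace ℝ (Fin 3))
    (hCs : ∀ s t, Cs s t = deriv (fun u => C u t) s)
    (hCt : ∀ s t, Ct s t = deriv (fun u => C s u) t)
    (E F G : ℝ → ℝ → ℝ)
    (hE : ∀ s t, E s t = ⟪Cs s t, Cs s t⟫)
    (hF : ∀ s t, F s t = ⟪Cs s t, Ct s t⟫)
    (hG : ∀ s t, G s t = ⟪Ct s t, Ct s t⟫)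
    (n : ℝ → ℝ → EuclideanSpace ℝ (Fin 3))
    (hn : ∀ s t, n s t = (r s)⁻¹ • (C s t - α s))
    (Css Cst Ctt : ℝ → ℝ → EuclideanSpace ℝ (Fin 3))
    (hCss : ∀ s t, Css s t = deriv (fun u => Cs u t) s)
    (hCst : ∀ s t, Cst s t = deriv (fun u => Cs s u) t)
    (hCtt : ∀ s t, Ctt s t = deriv (fun u => Ct s u) t)
    (e f g : ℝ → ℝ → ℝ)
    (he : ∀ s t, e s t = ⟪Css s t, n s t⟫)
    (hf : ∀ s t, f s t = ⟪Cst s t, n s t⟫)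
    (hg : ∀ s t, g s t = ⟪Ctt s t, n s t⟫)
    (H : ℝ → ℝ → ℝ)
    (hH : ∀ s t, H s t = (E s t * g s t - 2 * F s t * f s t + G s t * e s t)
      / (2 * (E s t * G s t - F s t ^ 2)))
    :
    ∀ s t : ℝ, E s t * G s t - F s t ^ 2 ≠ 0 →
      H s t = -(Q s ^ 2) / (2 * r s * (E s t * G s t - F s t ^ 2)) *
        (2 * κ s ^ 2 * (Q s ^ 2 + R s ^ 2) * Real.cos t ^ 2
          + κ s * (4 * (deriv Q s * R s - Q s * deriv R s) + 3 * Q s) * Real.cos t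
          + (deriv R s) ^ 2 + (deriv Q s) ^ 2 - 2 * deriv R s
          - R s * deriv (deriv R) s - Q s * deriv (deriv Q) s + 1) := by
  have hr' : ContDiff ℝ (⊤ : ℕ∞) (deriv r) := (contDiff_infty_iff_deriv.1 hr).2
  have hRd : ContDiff ℝ (⊤ : ℕ∞) R := by
    rw [funext hR]; exact hr.mul hr'
  have hQd : ContDiff ℝ (⊤ : ℕ∞) Q := by
    rw [funext hQ]
    refine hr.mul (ContDiff.sqrt (contDiff_const.sub (hr'.pow 2)) fun s => ?_)
    have := (sq_lt_one_iff_abs_lt_one _).2 (hr1 s)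
    exact (sub_pos.2 this).ne'
  have hasDeriv : ∀ {h : ℝ → ℝ}, ContDiff ℝ (⊤ : ℕ∞) h → ∀ s, HasDerivAt h (deriv h s) s :=
    fun hh s => (hh.differentiable (by simp) s).hasDerivAt
  have dR := hasDeriv hRd
  have dQ := hasDeriv hQd
  have dR' := hasDeriv (contDiff_infty_iff_deriv.1 hRd).2
  have dQ' := hasDeriv (contDiff_infty_iff_deriv.1 hQd).2
  have dκ := hasDeriv hκ
  have dτ := hasDeriv hτ
  have dα : ∀ s, HasDerivAt α (T s) s := fun s => by
    rw [hTα]; exact (hα.differentiable (by simp) s).hasDerivAt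
  have dT : ∀ s, HasDerivAt T (κ s • N s) s := fun s => by
    rw [← hT']; exact (hT.differentiable (by simp) s).hasDerivAt
  have dN : ∀ s, HasDerivAt N ((-κ s) • T s + τ s • B s) s := fun s => by
    rw [← hN']; exact (hN.differentiable (by simp) s).hasDerivAt
  have dB : ∀ s, HasDerivAt B ((-τ s) • N s) s := fun s => by
    rw [← hB']; exact (hB.differentiable (by simp) s).hasDerivAt
  have C_eq : ∀ s t, C s t = α s + ((-R s) • T s + (-(Q s * Real.cos t)) • N s
      + (Q s * Real.sin t) • B s) := fun s t => by rw [hC]; module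
  have Cs_eq : ∀ s t, Cs s t = (1 - deriv R s + κ s * (Q s * Real.cos t)) • T s
      + (-(deriv Q s * Real.cos t) - κ s * R s - τ s * (Q s * Real.sin t)) • N s
      + (deriv Q s * Real.sin t - τ s * (Q s * Real.cos t)) • B s := fun s t => by
    rw [hCs, funext fun u => C_eq u t]
    refine ((dα s).add (HasDerivAt.frenet_combination (dT s) (dN s) (dB s) (dR s).fun_neg
      ((dQ s).mul_const _).fun_neg ((dQ s).mul_const _))).deriv.trans ?_
    module
  have Ct_eq : ∀ s t, Ct s t = (0 : ℝ) • T s + (Q s * Real.sin t) • N s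
      + (Q s * Real.cos t) • B s := fun s t => by
    rw [hCt, funext fun u => C_eq s u]
    refine ((HasDerivAt.triple_combination_const (T s) (N s) (B s) (hasDerivAt_const t (-R s))
      ((Real.hasDerivAt_cos t).const_mul (Q s)).fun_neg
      ((Real.hasDerivAt_sin t).const_mul (Q s))).const_add (α s)).deriv.trans ?_
    module
  intro s t hdet
  have n_eq : n s t = ((r s)⁻¹ * (-R s)) • T s + ((r s)⁻¹ * -(Q s * Real.cos t)) • N s
      + ((r s)⁻¹ * (Q s * Real.sin t)) • B s := by
    rw [hn, C_eq]; module
  have Css_eq := hCss s t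
  rw [funext fun u => Cs_eq u t, (HasDerivAt.frenet_combination (dT s) (dN s) (dB s)
    (((dR' s).const_sub 1).fun_add ((dκ s).fun_mul ((dQ s).mul_const (Real.cos t))))
    ((((dQ' s).mul_const (Real.cos t)).fun_neg.fun_sub ((dκ s).fun_mul (dR s))).fun_sub
      ((dτ s).fun_mul ((dQ s).mul_const (Real.sin t))))
    (((dQ' s).mul_const (Real.sin t)).fun_sub
      ((dτ s).fun_mul ((dQ s).mul_const (Real.cos t))))).deriv] at Css_eq
  have Cst_eq := hCst s t
  rw [funext fun u => Cs_eq s u, (HasDerivAt.triple_combination_const (T s) (N s) (B s)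
    ((((Real.hasDerivAt_cos t).const_mul (Q s)).const_mul (κ s)).const_add (1 - deriv R s))
    ((((Real.hasDerivAt_cos t).const_mul (deriv Q s)).fun_neg.sub_const (κ s * R s)).fun_sub
      (((Real.hasDerivAt_sin t).const_mul (Q s)).const_mul (τ s)))
    (((Real.hasDerivAt_sin t).const_mul (deriv Q s)).fun_sub
      (((Real.hasDerivAt_cos t).const_mul (Q s)).const_mul (τ s)))).deriv] at Cst_eq
  have Ctt_eq := hCtt s t
  rw [funext fun u => Ct_eq s u, (HasDerivAt.triple_combination_const (T s) (N s) (B s)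
    (hasDerivAt_const t (0 : ℝ)) ((Real.hasDerivAt_sin t).const_mul (Q s))
    ((Real.hasDerivAt_cos t).const_mul (Q s))).deriv] at Ctt_eq
  have inner_eq := inner_orthonormal_triple_combination (hT1 s) (hN1 s) (hB1 s)
    (hTN s) (hTB s) (hNB s)
  have hE := hE s t
  have hF := hF s t
  have hG := hG s t
  have he := he s t
  have hf := hf s t
  have hg := hg s t
  rw [Cs_eq, inner_eq] at hE
  rw [Cs_eq, Ct_eq, inner_eq] at hF
  rw [Ct_eq, inner_eq] at hG
  rw [Css_eq, n_eq, inner_eq] at he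
  rw [Cst_eq, n_eq, inner_eq] at hf
  rw [Ctt_eq, n_eq, inner_eq] at hg
  have hsin : Real.sin t ^ 2 = 1 - Real.cos t ^ 2 := Real.sin_sq t
  have hrs : r s ≠ 0 := (hrpos s).ne'
  have F_eq : F s t = -(Q s * R s * κ s * Real.sin t + Q s ^ 2 * τ s) := by
    rw [hF]; linear_combination (-(Q s ^ 2 * τ s)) * hsin
  have G_eq : G s t = Q s ^ 2 := by
    rw [hG]; linear_combination Q s ^ 2 * hsin
  have f_eq : f s t = (r s)⁻¹ * (Q s * R s * κ s * Real.sin t + Q s ^ 2 * τ s) := by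
    rw [hf]; linear_combination ((r s)⁻¹ * Q s ^ 2 * τ s) * hsin
  have g_eq : g s t = -(r s)⁻¹ * Q s ^ 2 := by
    rw [hg]; linear_combination (-(r s)⁻¹ * Q s ^ 2) * hsin
  have numerator : E s t * g s t - 2 * F s t * f s t + G s t * e s t =
      -(Q s ^ 2) * (r s)⁻¹ *
        (2 * κ s ^ 2 * (Q s ^ 2 + R s ^ 2) * Real.cos t ^ 2
          + κ s * (4 * (deriv Q s * R s - Q s * deriv R s) + 3 * Q s) * Real.cos t
          + (deriv R s) ^ 2 + (deriv Q s) ^ 2 - 2 * deriv R s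
          - R s * deriv (deriv R) s - Q s * deriv (deriv Q) s + 1) := by
    rw [F_eq, f_eq, G_eq, g_eq, hE, he]
    ring_nf
    simp only [hsin]
    ring
  rw [hH, numerator]
  field_simp
end

section
/- Every canal surface of revolution is a (K,K_II)-Weingarten surface: if the curvature of the center curve vanishes identically (κ(s) = 0 for all s) and (EG − F²)(s,t) ≠ 0 and (eg − f²)(s,t) ≠ 0 for all (s,t), then the Jacobi equation Φ(K,K_II) = K_t·(K_II)_s − K_s·(K_II)_t = 0 holds at every point (s,t). -/
open scoped RealInnerProductSpace

theorem inner_orthonormal_triple {V : Type*} [NormedAddCommGroup V] [InnerProductSpace ℝ V]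
    {T N B : V} (hT : ‖T‖ = 1) (hN : ‖N‖ = 1) (hB : ‖B‖ = 1)
    (hTN : ⟪T, N⟫ = 0) (hTB : ⟪T, B⟫ = 0) (hNB : ⟪N, B⟫ = 0) (x y z x' y' z' : ℝ) :
    ⟪x • T + y • N + z • B, x' • T + y' • N + z' • B⟫ = x * x' + y * y' + z * z' := by
  have hNT : ⟪N, T⟫ = 0 := by rw [real_inner_comm, hTN]
  have hBT : ⟪B, T⟫ = 0 := by rw [real_inner_comm, hTB]
  have hBN : ⟪B, N⟫ = 0 := by rw [real_inner_comm, hNB]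
  simp only [inner_add_left, inner_add_right, real_inner_smul_left, real_inner_smul_right,
    real_inner_self_eq_norm_sq, hT, hN, hB, hTN, hTB, hNB, hNT, hBT, hBN]
  ring

theorem HasDerivAt.frame_combination {V : Type*} [NormedAddCommGroup V] [NormedSpace ℝ V]
    {T N B : ℝ → V} {τ s : ℝ} (hT : HasDerivAt T 0 s) (hN : HasDerivAt N (τ • B s) s)
    (hB : HasDerivAt B ((-τ) • N s) s) {x y z : ℝ → ℝ} {x' y' z' : ℝ}
    (hx : HasDerivAt x x' s) (hy : HasDerivAt y y' s) (hz : HasDerivAt z z' s) :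
    HasDerivAt (fun u => x u • T u + y u • N u + z u • B u)
      (x' • T s + (y' - τ * z s) • N s + (z' + τ * y s) • B s) s := by
  refine (((hx.smul hT).add (hy.smul hN)).add (hz.smul hB)).congr_deriv ?_
  module

theorem revolution_is_KKII_Weingarten
    (α T N B : ℝ → EuclideanSpace ℝ (Fin 3)) (κ τ r : ℝ → ℝ)
    (hα : ContDiff ℝ (⊤ : ℕ∞) α) (hT : ContDiff ℝ (⊤ : ℕ∞) T)
    (hN : ContDiff ℝ (⊤ : ℕ∞) N) (hB : ContDiff ℝ (⊤ : ℕ∞) B)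
    (hκ : ContDiff ℝ (⊤ : ℕ∞) κ) (hτ : ContDiff ℝ (⊤ : ℕ∞) τ)
    (hr : ContDiff ℝ (⊤ : ℕ∞) r)
    (hTα : ∀ s, T s = deriv α s)
    (hT1 : ∀ s, ‖T s‖ = 1) (hN1 : ∀ s, ‖N s‖ = 1) (hB1 : ∀ s, ‖B s‖ = 1)
    (hTN : ∀ s, ⟪T s, N s⟫ = 0) (hTB : ∀ s, ⟪T s, B s⟫ = 0)
    (hNB : ∀ s, ⟪N s, B s⟫ = 0)
    (hT' : ∀ s, deriv T s = κ s • N s)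
    (hN' : ∀ s, deriv N s = (-κ s) • T s + τ s • B s)
    (hB' : ∀ s, deriv B s = (-τ s) • N s)
    (hrpos : ∀ s, 0 < r s) (hr1 : ∀ s, |deriv r s| < 1)
    (R Q : ℝ → ℝ)
    (hR : ∀ s, R s = r s * deriv r s)
    (hQ : ∀ s, Q s = r s * Real.sqrt (1 - (deriv r s) ^ 2))
    (C : ℝ → ℝ → EuclideanSpace ℝ (Fin 3))
    (hC : ∀ s t, C s t = α s - R s • T s - (Q s * Real.cos t) • N s
      + (Q s * Real.sin t) • B s)
    (Cs Ct : ℝ → ℝ → EuclideanSpace ℝ (Fin 3))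
    (hCs : ∀ s t, Cs s t = deriv (fun u => C u t) s)
    (hCt : ∀ s t, Ct s t = deriv (fun u => C s u) t)
    (E F G : ℝ → ℝ → ℝ)
    (hE : ∀ s t, E s t = ⟪Cs s t, Cs s t⟫)
    (hF : ∀ s t, F s t = ⟪Cs s t, Ct s t⟫)
    (hG : ∀ s t, G s t = ⟪Ct s t, Ct s t⟫)
    (n : ℝ → ℝ → EuclideanSpace ℝ (Fin 3))
    (hn : ∀ s t, n s t = (r s)⁻¹ • (C s t - α s))
    (Css Cst Ctt : ℝ → ℝ → EuclideanSpace ℝ (Fin 3))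
    (hCss : ∀ s t, Css s t = deriv (fun u => Cs u t) s)
    (hCst : ∀ s t, Cst s t = deriv (fun u => Cs s u) t)
    (hCtt : ∀ s t, Ctt s t = deriv (fun u => Ct s u) t)
    (e f g : ℝ → ℝ → ℝ)
    (he : ∀ s t, e s t = ⟪Css s t, n s t⟫)
    (hf : ∀ s t, f s t = ⟪Cst s t, n s t⟫)
    (hg : ∀ s t, g s t = ⟪Ctt s t, n s t⟫)
    (K : ℝ → ℝ → ℝ)
    (hK : ∀ s t, K s t = (e s t * g s t - f s t ^ 2) / (E s t * G s t - F s t ^ 2))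
    (es et ett fs ft fst gs gt gss : ℝ → ℝ → ℝ)
    (hes : ∀ s t, es s t = deriv (fun u => e u t) s)
    (het : ∀ s t, et s t = deriv (fun u => e s u) t)
    (hett : ∀ s t, ett s t = deriv (fun u => et s u) t)
    (hfs : ∀ s t, fs s t = deriv (fun u => f u t) s)
    (hft : ∀ s t, ft s t = deriv (fun u => f s u) t)
    (hfst : ∀ s t, fst s t = deriv (fun u => fs s u) t)
    (hgs : ∀ s t, gs s t = deriv (fun u => g u t) s)
    (hgt : ∀ s t, gt s t = deriv (fun u => g s u) t)
    (hgss : ∀ s t, gss s t = deriv (fun u => gs u t) s)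
    (KII : ℝ → ℝ → ℝ)
    (hKII : ∀ s t, KII s t = (e s t * g s t - f s t ^ 2)⁻¹ ^ 2 *
      (Matrix.det !![-(1 / 2) * ett s t + fst s t - (1 / 2) * gss s t,
          (1 / 2) * es s t, fs s t - (1 / 2) * et s t;
          ft s t - (1 / 2) * gs s t, e s t, f s t;
          (1 / 2) * gt s t, f s t, g s t] -
        Matrix.det !![0, (1 / 2) * et s t, (1 / 2) * gs s t;
          (1 / 2) * et s t, e s t, f s t;
          (1 / 2) * gs s t, f s t, g s t]))
    (Ks Kt : ℝ → ℝ → ℝ)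
    (hKs : ∀ s t, Ks s t = deriv (fun u => K u t) s)
    (hKt : ∀ s t, Kt s t = deriv (fun u => K s u) t)
    (KIIs KIIt : ℝ → ℝ → ℝ)
    (hKIIs : ∀ s t, KIIs s t = deriv (fun u => KII u t) s)
    (hKIIt : ∀ s t, KIIt s t = deriv (fun u => KII s u) t)
    (hκ0 : ∀ s, κ s = 0)
    (hreg : ∀ s t, E s t * G s t - F s t ^ 2 ≠ 0)
    (hreg2 : ∀ s t, e s t * g s t - f s t ^ 2 ≠ 0)
    :
    ∀ s t : ℝ, Kt s t * KIIs s t - Ks s t * KIIt s t = 0 := by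
  have hsq (s : ℝ) : 0 < 1 - deriv r s ^ 2 := by
    have := (sq_lt_one_iff_abs_lt_one _).2 (hr1 s)
    linarith
  have hr' : ContDiff ℝ (⊤ : ℕ∞) (deriv r) := (contDiff_infty_iff_deriv.1 hr).2
  have hRs : ContDiff ℝ (⊤ : ℕ∞) R := by
    rw [funext hR]
    exact hr.mul hr'
  have hQs : ContDiff ℝ (⊤ : ℕ∞) Q := by
    rw [funext hQ]
    exact hr.mul ((contDiff_const.sub (hr'.pow 2)).sqrt fun s => (hsq s).ne')
  have hasDeriv {φ : ℝ → ℝ} (h : ContDiff ℝ (⊤ : ℕ∞) φ) (s : ℝ) :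
      HasDerivAt φ (deriv φ s) s :=
    (contDiff_infty_iff_deriv.1 h).1.differentiableAt.hasDerivAt
  have hRs' := (contDiff_infty_iff_deriv.1 hRs).2
  have hQs' := (contDiff_infty_iff_deriv.1 hQs).2
  have dα (s : ℝ) : HasDerivAt α (T s) s := by
    rw [hTα]
    exact (contDiff_infty_iff_deriv.1 hα).1.differentiableAt.hasDerivAt
  have dT (s : ℝ) : HasDerivAt T 0 s :=
    (contDiff_infty_iff_deriv.1 hT).1.differentiableAt.hasDerivAt.congr_deriv
      (by rw [hT', hκ0, zero_smul])
  have dN (s : ℝ) : HasDerivAt N (τ s • B s) s :=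
    (contDiff_infty_iff_deriv.1 hN).1.differentiableAt.hasDerivAt.congr_deriv
      (by rw [hN', hκ0, neg_zero, zero_smul, zero_add])
  have dB (s : ℝ) : HasDerivAt B ((-τ s) • N s) s :=
    (contDiff_infty_iff_deriv.1 hB).1.differentiableAt.hasDerivAt.congr_deriv (hB' s)
  have frame_C (s t : ℝ) : C s t = α s + ((-R s) • T s + (-(Q s * Real.cos t)) • N s
      + (Q s * Real.sin t) • B s) := by
    rw [hC]
    module
  have frame_Cs (s t : ℝ) : Cs s t = (1 - deriv R s) • T s
      + (-(deriv Q s * Real.cos t) - τ s * (Q s * Real.sin t)) • N s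
      + (deriv Q s * Real.sin t - τ s * (Q s * Real.cos t)) • B s := by
    rw [hCs, funext fun u => frame_C u t]
    refine ((dα s).add ((dT s).frame_combination (dN s) (dB s) (hasDeriv hRs s).fun_neg
      ((hasDeriv hQs s).mul_const _).fun_neg ((hasDeriv hQs s).mul_const _))).deriv.trans ?_
    module
  have frame_Ct (s t : ℝ) : Ct s t = (0 : ℝ) • T s + (Q s * Real.sin t) • N s
      + (Q s * Real.cos t) • B s := by
    rw [hCt, funext fun u => frame_C s u]
    refine ((((hasDerivAt_const t _).add
      (((Real.hasDerivAt_cos t).const_mul (Q s)).neg.smul_const (N s))).add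
      (((Real.hasDerivAt_sin t).const_mul (Q s)).smul_const (B s))).const_add
        (α s)).deriv.trans ?_
    module
  have frame_Css (s t : ℝ) : Css s t = (-deriv (deriv R) s) • T s
      + (-(deriv (deriv Q) s * Real.cos t)
          - (deriv τ s * (Q s * Real.sin t) + τ s * (deriv Q s * Real.sin t))
          - τ s * (deriv Q s * Real.sin t - τ s * (Q s * Real.cos t))) • N s
      + (deriv (deriv Q) s * Real.sin t
          - (deriv τ s * (Q s * Real.cos t) + τ s * (deriv Q s * Real.cos t))
          + τ s * (-(deriv Q s * Real.cos t) - τ s * (Q s * Real.sin t))) • B s := by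
    rw [hCss, funext fun u => frame_Cs u t]
    exact ((dT s).frame_combination (dN s) (dB s) ((hasDeriv hRs' s).const_sub 1)
      (((hasDeriv hQs' s).mul_const _).neg.sub
        ((hasDeriv hτ s).mul ((hasDeriv hQs s).mul_const _)))
      (((hasDeriv hQs' s).mul_const _).sub
        ((hasDeriv hτ s).mul ((hasDeriv hQs s).mul_const _)))).deriv
  have frame_Cst (s t : ℝ) : Cst s t = (0 : ℝ) • T s
      + (deriv Q s * Real.sin t - τ s * (Q s * Real.cos t)) • N s
      + (deriv Q s * Real.cos t + τ s * (Q s * Real.sin t)) • B s := by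
    rw [hCst, funext fun u => frame_Cs s u]
    refine (((hasDerivAt_const t _).add
      ((((Real.hasDerivAt_cos t).const_mul _).neg.sub
        (((Real.hasDerivAt_sin t).const_mul _).const_mul _)).smul_const (N s))).add
      ((((Real.hasDerivAt_sin t).const_mul _).sub
        (((Real.hasDerivAt_cos t).const_mul _).const_mul _)).smul_const (B s))).deriv.trans ?_
    module
  have frame_Ctt (s t : ℝ) : Ctt s t = (0 : ℝ) • T s + (Q s * Real.cos t) • N s
      + (-(Q s * Real.sin t)) • B s := by
    rw [hCtt, funext fun u => frame_Ct s u]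
    refine (((hasDerivAt_const t _).add
      (((Real.hasDerivAt_sin t).const_mul (Q s)).smul_const (N s))).add
      (((Real.hasDerivAt_cos t).const_mul (Q s)).smul_const (B s))).deriv.trans ?_
    module
  have frame_n (s t : ℝ) : n s t = (-((r s)⁻¹ * R s)) • T s
      + (-((r s)⁻¹ * (Q s * Real.cos t))) • N s
      + ((r s)⁻¹ * (Q s * Real.sin t)) • B s := by
    rw [hn, frame_C]
    module
  have inner_frame (s : ℝ) := inner_orthonormal_triple (hT1 s) (hN1 s) (hB1 s) (hTN s) (hTB s)
    (hNB s)
  have eval_E (s t : ℝ) :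
      E s t = (1 - deriv R s) ^ 2 + deriv Q s ^ 2 + τ s ^ 2 * Q s ^ 2 := by
    rw [hE, frame_Cs, inner_frame]
    linear_combination (deriv Q s ^ 2 + τ s ^ 2 * Q s ^ 2) * Real.sin_sq_add_cos_sq t
  have eval_F (s t : ℝ) : F s t = -(τ s * Q s ^ 2) := by
    rw [hF, frame_Cs, frame_Ct, inner_frame]
    linear_combination (-(τ s * Q s ^ 2)) * Real.sin_sq_add_cos_sq t
  have eval_G (s t : ℝ) : G s t = Q s ^ 2 := by
    rw [hG, frame_Ct, inner_frame]
    linear_combination Q s ^ 2 * Real.sin_sq_add_cos_sq t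
  have eval_e (s t : ℝ) : e s t =
      (r s)⁻¹ * (R s * deriv (deriv R) s + Q s * (deriv (deriv Q) s - τ s ^ 2 * Q s)) := by
    rw [he, frame_Css, frame_n, inner_frame]
    linear_combination (r s)⁻¹ * Q s * (deriv (deriv Q) s - τ s ^ 2 * Q s) *
      Real.sin_sq_add_cos_sq t
  have eval_f (s t : ℝ) : f s t = (r s)⁻¹ * (τ s * Q s ^ 2) := by
    rw [hf, frame_Cst, frame_n, inner_frame]
    linear_combination (r s)⁻¹ * (τ s * Q s ^ 2) * Real.sin_sq_add_cos_sq t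
  have eval_g (s t : ℝ) : g s t = -((r s)⁻¹ * Q s ^ 2) := by
    rw [hg, frame_Ctt, frame_n, inner_frame]
    linear_combination (-((r s)⁻¹ * Q s ^ 2)) * Real.sin_sq_add_cos_sq t
  intro s t
  have hKt0 : Kt s t = 0 := by
    simp only [hKt, hK, eval_E, eval_F, eval_G, eval_e, eval_f, eval_g, deriv_const]
  have hKIIt0 : KIIt s t = 0 := by
    simp only [hKIIt, hKII, hett, het, hes, hfst, hfs, hft, hgss, hgs, hgt, eval_e, eval_f,
      eval_g, deriv_const]
  rw [hKt0, hKIIt0, zero_mul, mul_zero, sub_zero]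
end

section
/- A (K,K_II)-linear Weingarten canal surface has a straight center curve: let a, b, d ∈ ℝ with b ≠ 0, suppose (EG − F²)(s,t) ≠ 0 and (eg − f²)(s,t) ≠ 0 for all (s,t), and a·K(s,t) + b·K_II(s,t) = d for all (s,t). Then κ(s) = 0 for all s. -/
open scoped RealInnerProductSpace

section Frame

variable {V : Type*} [NormedAddCommGroup V] [InnerProductSpace ℝ V]

theorem inner_combination_of_orthonormal {T N B : V} (hT : ‖T‖ = 1) (hN : ‖N‖ = 1)
    (hB : ‖B‖ = 1) (hTN : ⟪T, N⟫ = 0) (hTB : ⟪T, B⟫ = 0) (hNB : ⟪N, B⟫ = 0)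
    (x y z x' y' z' : ℝ) :
    ⟪x • T + y • N + z • B, x' • T + y' • N + z' • B⟫ = x * x' + y * y' + z * z' := by
  have hNT : ⟪N, T⟫ = 0 := by rw [real_inner_comm, hTN]
  have hBT : ⟪B, T⟫ = 0 := by rw [real_inner_comm, hTB]
  have hBN : ⟪B, N⟫ = 0 := by rw [real_inner_comm, hNB]
  simp only [inner_add_left, inner_add_right, real_inner_smul_left, real_inner_smul_right,
    real_inner_self_eq_norm_sq, hT, hN, hB, hTN, hTB, hNB, hNT, hBT, hBN]
  ring

theorem HasDerivAt.combination_const {x y z : ℝ → ℝ} {x' y' z' t : ℝ} (T N B : V)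
    (hx : HasDerivAt x x' t) (hy : HasDerivAt y y' t) (hz : HasDerivAt z z' t) :
    HasDerivAt (fun v => x v • T + y v • N + z v • B) (x' • T + y' • N + z' • B) t :=
  ((hx.smul_const T).add (hy.smul_const N)).add (hz.smul_const B)

theorem HasDerivAt.combination_frenet {T N B : ℝ → V} {κ τ s : ℝ}
    (hT : HasDerivAt T (κ • N s) s) (hN : HasDerivAt N ((-κ) • T s + τ • B s) s)
    (hB : HasDerivAt B ((-τ) • N s) s) {x y z : ℝ → ℝ} {x' y' z' : ℝ}
    (hx : HasDerivAt x x' s) (hy : HasDerivAt y y' s) (hz : HasDerivAt z z' s) :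
    HasDerivAt (fun v => x v • T v + y v • N v + z v • B v)
      ((x' - κ * y s) • T s + (y' + κ * x s - τ * z s) • N s + (z' + τ * y s) • B s) s := by
  refine (((hx.smul hT).add (hy.smul hN)).add (hz.smul hB)).congr_deriv ?_
  module

end Frame

/-- The numerator of the curvature, in the sense of the second Gaussian curvature, of the quadratic
form `-(h ds² + G (dt - p ds)²)` with `G` depending on `s` only, `h = A + c A²`,
`A = u cos t - z` and `p = τ + k sin t`. -/
theorem brioschi_numerator_eq {u z c k τ G : ℝ → ℝ}
    (hu : ContDiff ℝ (⊤ : ℕ∞) u) (hz : ContDiff ℝ (⊤ : ℕ∞) z) (hc : ContDiff ℝ (⊤ : ℕ∞) c)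
    (hk : ContDiff ℝ (⊤ : ℕ∞) k) (hτ : ContDiff ℝ (⊤ : ℕ∞) τ) (hG : ContDiff ℝ (⊤ : ℕ∞) G)
    {e f g es et ett fs ft fst gs gt gss : ℝ → ℝ → ℝ}
    (he : ∀ s t, e s t = -(u s * Real.cos t - z s + c s * (u s * Real.cos t - z s) ^ 2
      + G s * (τ s + k s * Real.sin t) ^ 2))
    (hf : ∀ s t, f s t = G s * (τ s + k s * Real.sin t))
    (hg : ∀ s t, g s t = -G s)
    (hes : ∀ s t, es s t = deriv (fun u => e u t) s)
    (het : ∀ s t, et s t = deriv (fun u => e s u) t)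
    (hett : ∀ s t, ett s t = deriv (fun u => et s u) t)
    (hfs : ∀ s t, fs s t = deriv (fun u => f u t) s)
    (hft : ∀ s t, ft s t = deriv (fun u => f s u) t)
    (hfst : ∀ s t, fst s t = deriv (fun u => fs s u) t)
    (hgs : ∀ s t, gs s t = deriv (fun u => g u t) s)
    (hgt : ∀ s t, gt s t = deriv (fun u => g s u) t)
    (hgss : ∀ s t, gss s t = deriv (fun u => gs u t) s) (s t A As At Att h p M : ℝ)
    (hA : A = u s * Real.cos t - z s) (hAs : As = deriv u s * Real.cos t - deriv z s)
    (hAt : At = -(u s * Real.sin t)) (hAtt : Att = -(u s * Real.cos t))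
    (hh : h = A + c s * A ^ 2) (hp : p = τ s + k s * Real.sin t)
    (hM : M = deriv G s / 2 + G s * (k s * Real.cos t)) :
    Matrix.det !![-(1 / 2) * ett s t + fst s t - (1 / 2) * gss s t,
          (1 / 2) * es s t, fs s t - (1 / 2) * et s t;
          ft s t - (1 / 2) * gs s t, e s t, f s t;
          (1 / 2) * gt s t, f s t, g s t] -
        Matrix.det !![0, (1 / 2) * et s t, (1 / 2) * gs s t;
          (1 / 2) * et s t, e s t, f s t;
          (1 / 2) * gs s t, f s t, g s t] =
      G s * (((1 + 2 * c s * A) * Att + 2 * c s * At ^ 2) * h / 2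
        - ((1 + 2 * c s * A) * At) ^ 2 / 4)
      + h * (G s * (deriv (deriv G) s / 2
            + (deriv G s * k s + G s * deriv k s) * Real.cos t
            - G s * (k s * Real.sin t) * p + M * (k s * Real.cos t)) - deriv G s / 2 * M)
      - G s * M * ((1 + 2 * c s * A) * As + deriv c s * A ^ 2
          + p * ((1 + 2 * c s * A) * At)) / 2 := by
  have deriv_at {φ : ℝ → ℝ} (hφ : ContDiff ℝ (⊤ : ℕ∞) φ) (s : ℝ) : HasDerivAt φ (deriv φ s) s :=
    (hφ.differentiable (by simp) s).hasDerivAt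
  have hG' : ContDiff ℝ (⊤ : ℕ∞) (deriv G) := hG.deriv'
  obtain rfl : e = _ := funext₂ he
  obtain rfl : f = _ := funext₂ hf
  obtain rfl : g = _ := funext₂ hg
  have angle (x y t : ℝ) : HasDerivAt (fun v => x * Real.cos v - y) (-(x * Real.sin t)) t := by
    simpa using ((Real.hasDerivAt_cos t).const_mul x).sub_const y
  have shift (x y t : ℝ) : HasDerivAt (fun v => x + y * Real.sin v) (y * Real.cos t) t := by
    simpa using ((Real.hasDerivAt_sin t).const_mul y).const_add x
  have hAd := ((deriv_at hu s).mul_const (Real.cos t)).sub (deriv_at hz s)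
  have hpd (s t : ℝ) := (deriv_at hτ s).add ((deriv_at hk s).mul_const (Real.sin t))
  have es_eq : es s t = -(As + (deriv c s * A ^ 2 + c s * (2 * A * As))
      + (deriv G s * p ^ 2 + G s * (2 * p * (deriv τ s + deriv k s * Real.sin t)))) := by
    rw [hes]
    refine (((hAd.add ((deriv_at hc s).mul (hAd.pow 2))).add
      ((deriv_at hG s).mul ((hpd s t).pow 2))).neg.congr_deriv ?_).deriv
    simp [hA, hAs, hp]
  have et_eq (t : ℝ) : et s t = -(-(u s * Real.sin t)
      + c s * (2 * (u s * Real.cos t - z s) * (-(u s * Real.sin t)))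
      + G s * (2 * (τ s + k s * Real.sin t) * (k s * Real.cos t))) := by
    rw [het]
    refine ((((angle (u s) (z s) t).add (((angle (u s) (z s) t).pow 2).const_mul (c s))).add
      (((shift (τ s) (k s) t).pow 2).const_mul (G s))).neg.congr_deriv ?_).deriv
    simp
  have ett_eq : ett s t = -(-(u s * Real.cos t)
      + c s * (2 * (-(u s * Real.sin t)) * (-(u s * Real.sin t))
        + 2 * (u s * Real.cos t - z s) * (-(u s * Real.cos t)))
      + G s * (2 * (k s * Real.cos t) * (k s * Real.cos t)
        + 2 * (τ s + k s * Real.sin t) * (-(k s * Real.sin t)))) := by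
    rw [hett, funext et_eq]
    have hsin := ((Real.hasDerivAt_sin t).const_mul (u s)).neg
    have hcos := (Real.hasDerivAt_cos t).const_mul (k s)
    refine (((hsin.add ((((angle (u s) (z s) t).const_mul 2).mul hsin).const_mul (c s))).add
      ((((shift (τ s) (k s) t).const_mul 2).mul hcos).const_mul (G s))).neg.congr_deriv ?_).deriv
    simp only [Pi.neg_apply]
    ring
  have fs_eq (t : ℝ) : fs s t = deriv G s * (τ s + k s * Real.sin t)
      + G s * (deriv τ s + deriv k s * Real.sin t) := by
    rw [hfs]
    exact ((deriv_at hG s).mul (hpd s t)).deriv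
  have ft_eq : ft s t = G s * (k s * Real.cos t) := by
    rw [hft]
    exact ((shift (τ s) (k s) t).const_mul (G s)).deriv
  have fst_eq : fst s t = deriv G s * (k s * Real.cos t) + G s * (deriv k s * Real.cos t) := by
    rw [hfst, funext fs_eq]
    exact (((shift (τ s) (k s) t).const_mul _).add
      ((shift (deriv τ s) (deriv k s) t).const_mul _)).deriv
  have gs_eq (s : ℝ) : gs s t = -deriv G s := by
    rw [hgs]
    exact (deriv_at hG s).neg.deriv
  have gt_eq : gt s t = 0 := by simp [hgt]
  have gss_eq : gss s t = -deriv (deriv G) s := by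
    rw [hgss, funext gs_eq]
    exact (deriv_at hG' s).neg.deriv
  simp only [Matrix.det_fin_three, Matrix.of_apply, Matrix.cons_val', Matrix.cons_val_zero,
    Matrix.cons_val_one, Matrix.cons_val, es_eq, et_eq, ett_eq, fs_eq, ft_eq, fst_eq, gs_eq,
    gt_eq, gss_eq]
  subst hh hA hAs hAt hAtt hp hM
  ring

theorem coeffs_eq_zero_of_forall_mem_Icc {c₀ c₁ c₂ c₃ c₄ u z : ℝ} (hu : u ≠ 0)
    (h : ∀ x ∈ Set.Icc (-1 : ℝ) 1,
      c₀ + c₁ * x + c₂ * (u * x - z) ^ 2 + c₃ * (u * x - z) ^ 3 + c₄ * (u * x - z) ^ 4 = 0) :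
    c₂ = 0 ∧ c₃ = 0 ∧ c₄ = 0 := by
  have h₁ := h (-1) (by norm_num)
  have h₂ := h (-(1 / 2)) (by norm_num)
  have h₃ := h 0 (by norm_num)
  have h₄ := h (1 / 2) (by norm_num)
  have h₅ := h 1 (by norm_num)
  have hc₄ : c₄ = 0 := by
    have : c₄ * u ^ 4 = 0 := by
      linear_combination 2 / 3 * (h₁ - 4 * h₂ + 6 * h₃ - 4 * h₄ + h₅)
    simpa [hu] using this
  subst hc₄
  have hc₃ : c₃ = 0 := by
    have : c₃ * u ^ 3 = 0 := by
      linear_combination 2 / 3 * (h₅ - 2 * h₄ + 2 * h₂ - h₁)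
    simpa [hu] using this
  subst hc₃
  have hc₂ : c₂ = 0 := by
    have : c₂ * u ^ 2 = 0 := by
      linear_combination 1 / 2 * (h₅ - 2 * h₃ + h₁)
    simpa [hu] using this
  exact ⟨hc₂, rfl, rfl⟩

theorem brioschi_numerator_add_numerator_neg {r u τ : ℝ → ℝ}
    (hr : ContDiff ℝ (⊤ : ℕ∞) r) (hu : ContDiff ℝ (⊤ : ℕ∞) u) (hτ : ContDiff ℝ (⊤ : ℕ∞) τ)
    (hr0 : ∀ s, r s ≠ 0) (hr1 : ∀ s, 1 - deriv r s ^ 2 ≠ 0)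
    {e f g es et ett fs ft fst gs gt gss num : ℝ → ℝ → ℝ}
    (he : ∀ s t, e s t = -(u s * Real.cos t - deriv (deriv r) s
      + r s / (1 - deriv r s ^ 2) * (u s * Real.cos t - deriv (deriv r) s) ^ 2
      + r s * (1 - deriv r s ^ 2)
        * (τ s + deriv r s * u s / (1 - deriv r s ^ 2) * Real.sin t) ^ 2))
    (hf : ∀ s t, f s t = r s * (1 - deriv r s ^ 2)
      * (τ s + deriv r s * u s / (1 - deriv r s ^ 2) * Real.sin t))
    (hg : ∀ s t, g s t = -(r s * (1 - deriv r s ^ 2)))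
    (hes : ∀ s t, es s t = deriv (fun u => e u t) s)
    (het : ∀ s t, et s t = deriv (fun u => e s u) t)
    (hett : ∀ s t, ett s t = deriv (fun u => et s u) t)
    (hfs : ∀ s t, fs s t = deriv (fun u => f u t) s)
    (hft : ∀ s t, ft s t = deriv (fun u => f s u) t)
    (hfst : ∀ s t, fst s t = deriv (fun u => fs s u) t)
    (hgs : ∀ s t, gs s t = deriv (fun u => g u t) s)
    (hgt : ∀ s t, gt s t = deriv (fun u => g s u) t)
    (hgss : ∀ s t, gss s t = deriv (fun u => gs u t) s)
    (hnum : ∀ s t, num s t =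
      Matrix.det !![-(1 / 2) * ett s t + fst s t - (1 / 2) * gss s t,
          (1 / 2) * es s t, fs s t - (1 / 2) * et s t;
          ft s t - (1 / 2) * gs s t, e s t, f s t;
          (1 / 2) * gt s t, f s t, g s t] -
        Matrix.det !![0, (1 / 2) * et s t, (1 / 2) * gs s t;
          (1 / 2) * et s t, e s t, f s t;
          (1 / 2) * gs s t, f s t, g s t])
    (s t A Q : ℝ) (hA : A = u s * Real.cos t - deriv (deriv r) s) (hQ : Q = 1 - deriv r s ^ 2) :
    num s t + num s (-t) = -2 * (r s * Q)
      * (Q / 4 * (u s ^ 2 - deriv (deriv r) s ^ 2 - deriv r s * deriv (deriv (deriv r)) s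
            + deriv r s * deriv u s * Real.cos t)
          + A * (Q / (4 * r s) - Q ^ 2 / (4 * r s) - Q * deriv (deriv r) s + deriv (deriv r) s / 2)
          + Q / 4 * A ^ 2 + 3 / 2 * r s * A ^ 3 + r s ^ 2 / Q * A ^ 4) := by
  have deriv_at {φ : ℝ → ℝ} (hφ : ContDiff ℝ (⊤ : ℕ∞) φ) (s : ℝ) : HasDerivAt φ (deriv φ s) s :=
    (hφ.differentiable (by simp) s).hasDerivAt
  have hy : ContDiff ℝ (⊤ : ℕ∞) (deriv r) := hr.deriv'
  have hz : ContDiff ℝ (⊤ : ℕ∞) (deriv (deriv r)) := hy.deriv'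
  have hq : ContDiff ℝ (⊤ : ℕ∞) fun s => 1 - deriv r s ^ 2 := contDiff_const.sub (hy.pow 2)
  have hq' (s : ℝ) : HasDerivAt (fun s => 1 - deriv r s ^ 2)
      (-(2 * deriv r s * deriv (deriv r) s)) s :=
    (((deriv_at hy s).pow 2).const_sub 1).congr_deriv (by simp)
  have c_deriv : deriv (fun s => r s / (1 - deriv r s ^ 2)) s =
      (deriv r s * (1 - deriv r s ^ 2) + 2 * r s * deriv r s * deriv (deriv r) s)
        / (1 - deriv r s ^ 2) ^ 2 :=
    (((deriv_at hr s).div (hq' s) (hr1 s)).congr_deriv (by ring)).deriv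
  have k_deriv : deriv (fun s => deriv r s * u s / (1 - deriv r s ^ 2)) s =
      ((deriv (deriv r) s * u s + deriv r s * deriv u s) * (1 - deriv r s ^ 2)
        + 2 * deriv r s ^ 2 * u s * deriv (deriv r) s) / (1 - deriv r s ^ 2) ^ 2 :=
    ((((deriv_at hy s).mul (deriv_at hu s)).div (hq' s) (hr1 s)).congr_deriv
      (by simp only [Pi.mul_apply]; ring)).deriv
  have G_deriv (s : ℝ) : deriv (fun s => r s * (1 - deriv r s ^ 2)) s =
      deriv r s * (1 - deriv r s ^ 2) + r s * (-(2 * deriv r s * deriv (deriv r) s)) :=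
    ((deriv_at hr s).mul (hq' s)).deriv
  have G_deriv₂ : deriv (deriv fun s => r s * (1 - deriv r s ^ 2)) s =
      deriv (deriv r) s * (1 - deriv r s ^ 2) - 4 * deriv r s ^ 2 * deriv (deriv r) s
        - 2 * r s * deriv (deriv r) s ^ 2 - 2 * r s * deriv r s * deriv (deriv (deriv r)) s := by
    rw [funext G_deriv]
    exact ((((deriv_at hy s).mul (hq' s)).add ((deriv_at hr s).mul
      ((((deriv_at hy s).const_mul 2).mul (deriv_at hz s)).neg))).congr_deriv
        (by simp only [Pi.neg_apply, Pi.mul_apply]; ring)).deriv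
  have num_eq (t : ℝ) := (hnum s t).trans <| brioschi_numerator_eq hu hz
    (c := fun s => r s / (1 - deriv r s ^ 2)) (k := fun s => deriv r s * u s / (1 - deriv r s ^ 2))
    (G := fun s => r s * (1 - deriv r s ^ 2)) (hr.div hq hr1) ((hy.mul hu).div hq hr1) hτ
    (hr.mul hq) he hf hg hes het hett hfs hft hfst hgs hgt hgss s t
    _ _ _ _ _ _ _ rfl rfl rfl rfl rfl rfl rfl
  simp only [num_eq, c_deriv, k_deriv, G_deriv, G_deriv₂, Real.cos_neg, Real.sin_neg, ← hA, ← hQ]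
  have hr0s := hr0 s
  have hr1s : Q ≠ 0 := hQ ▸ hr1 s
  have hx : Real.sin t ^ 2 = 1 - Real.cos t ^ 2 := by linarith [Real.sin_sq_add_cos_sq t]
  generalize deriv (deriv (deriv r)) s = w at *
  generalize deriv (deriv r) s = z at *
  generalize deriv r s = y at *
  generalize deriv u s = u' at *
  generalize r s = r₀ at *
  generalize u s = u₀ at *
  generalize τ s = τ₀ at *
  generalize Real.cos t = x at *
  generalize Real.sin t = σ at *
  clear num_eq
  obtain ⟨k, hk⟩ : ∃ k, k = y * u₀ / Q := ⟨_, rfl⟩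
  obtain ⟨G, hG⟩ : ∃ G, G = r₀ * Q := ⟨_, rfl⟩
  obtain ⟨M, hM⟩ : ∃ M, M = (y * Q + r₀ * -(2 * y * z)) / 2 + G * (k * x) := ⟨_, rfl⟩
  linear_combination (norm := skip) (2 * (G * (r₀ / Q) * u₀ ^ 2 * (A + r₀ / Q * A ^ 2)
    - G * (1 + 2 * (r₀ / Q) * A) ^ 2 * u₀ ^ 2 / 4 - G ^ 2 * k ^ 2 * (A + r₀ / Q * A ^ 2)
    + G * M * k * u₀ * (1 + 2 * (r₀ / Q) * A) / 2)) * hx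
  simp only [hM, hG, hk]
  field_simp
  subst hA hQ
  ring

theorem KKII_linear_Weingarten_straight_center
    (α T N B : ℝ → EuclideanSpace ℝ (Fin 3)) (κ τ r : ℝ → ℝ)
    (hα : ContDiff ℝ (⊤ : ℕ∞) α) (hT : ContDiff ℝ (⊤ : ℕ∞) T)
    (hN : ContDiff ℝ (⊤ : ℕ∞) N) (hB : ContDiff ℝ (⊤ : ℕ∞) B)
    (hκ : ContDiff ℝ (⊤ : ℕ∞) κ) (hτ : ContDiff ℝ (⊤ : ℕ∞) τ)
    (hr : ContDiff ℝ (⊤ : ℕ∞) r)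
    (hTα : ∀ s, T s = deriv α s)
    (hT1 : ∀ s, ‖T s‖ = 1) (hN1 : ∀ s, ‖N s‖ = 1) (hB1 : ∀ s, ‖B s‖ = 1)
    (hTN : ∀ s, ⟪T s, N s⟫ = 0) (hTB : ∀ s, ⟪T s, B s⟫ = 0)
    (hNB : ∀ s, ⟪N s, B s⟫ = 0)
    (hT' : ∀ s, deriv T s = κ s • N s)
    (hN' : ∀ s, deriv N s = (-κ s) • T s + τ s • B s)
    (hB' : ∀ s, deriv B s = (-τ s) • N s)
    (hrpos : ∀ s, 0 < r s) (hr1 : ∀ s, |deriv r s| < 1)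
    (R Q : ℝ → ℝ)
    (hR : ∀ s, R s = r s * deriv r s)
    (hQ : ∀ s, Q s = r s * Real.sqrt (1 - (deriv r s) ^ 2))
    (C : ℝ → ℝ → EuclideanSpace ℝ (Fin 3))
    (hC : ∀ s t, C s t = α s - R s • T s - (Q s * Real.cos t) • N s
      + (Q s * Real.sin t) • B s)
    (Cs Ct : ℝ → ℝ → EuclideanSpace ℝ (Fin 3))
    (hCs : ∀ s t, Cs s t = deriv (fun u => C u t) s)
    (hCt : ∀ s t, Ct s t = deriv (fun u => C s u) t)
    (E F G : ℝ → ℝ → ℝ)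
    (hE : ∀ s t, E s t = ⟪Cs s t, Cs s t⟫)
    (hF : ∀ s t, F s t = ⟪Cs s t, Ct s t⟫)
    (hG : ∀ s t, G s t = ⟪Ct s t, Ct s t⟫)
    (n : ℝ → ℝ → EuclideanSpace ℝ (Fin 3))
    (hn : ∀ s t, n s t = (r s)⁻¹ • (C s t - α s))
    (Css Cst Ctt : ℝ → ℝ → EuclideanSpace ℝ (Fin 3))
    (hCss : ∀ s t, Css s t = deriv (fun u => Cs u t) s)
    (hCst : ∀ s t, Cst s t = deriv (fun u => Cs s u) t)
    (hCtt : ∀ s t, Ctt s t = deriv (fun u => Ct s u) t)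
    (e f g : ℝ → ℝ → ℝ)
    (he : ∀ s t, e s t = ⟪Css s t, n s t⟫)
    (hf : ∀ s t, f s t = ⟪Cst s t, n s t⟫)
    (hg : ∀ s t, g s t = ⟪Ctt s t, n s t⟫)
    (K : ℝ → ℝ → ℝ)
    (hK : ∀ s t, K s t = (e s t * g s t - f s t ^ 2) / (E s t * G s t - F s t ^ 2))
    (es et ett fs ft fst gs gt gss : ℝ → ℝ → ℝ)
    (hes : ∀ s t, es s t = deriv (fun u => e u t) s)
    (het : ∀ s t, et s t = deriv (fun u => e s u) t)
    (hett : ∀ s t, ett s t = deriv (fun u => et s u) t)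
    (hfs : ∀ s t, fs s t = deriv (fun u => f u t) s)
    (hft : ∀ s t, ft s t = deriv (fun u => f s u) t)
    (hfst : ∀ s t, fst s t = deriv (fun u => fs s u) t)
    (hgs : ∀ s t, gs s t = deriv (fun u => g u t) s)
    (hgt : ∀ s t, gt s t = deriv (fun u => g s u) t)
    (hgss : ∀ s t, gss s t = deriv (fun u => gs u t) s)
    (KII : ℝ → ℝ → ℝ)
    (hKII : ∀ s t, KII s t = (e s t * g s t - f s t ^ 2)⁻¹ ^ 2 *
      (Matrix.det !![-(1 / 2) * ett s t + fst s t - (1 / 2) * gss s t,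
          (1 / 2) * es s t, fs s t - (1 / 2) * et s t;
          ft s t - (1 / 2) * gs s t, e s t, f s t;
          (1 / 2) * gt s t, f s t, g s t] -
        Matrix.det !![0, (1 / 2) * et s t, (1 / 2) * gs s t;
          (1 / 2) * et s t, e s t, f s t;
          (1 / 2) * gs s t, f s t, g s t]))
    (a b d : ℝ) (hb : b ≠ 0)
    (hreg : ∀ s t, E s t * G s t - F s t ^ 2 ≠ 0)
    (hreg2 : ∀ s t, e s t * g s t - f s t ^ 2 ≠ 0)
    (hlin : ∀ s t : ℝ, a * K s t + b * KII s t = d)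
    :
    ∀ s : ℝ, κ s = 0 := by
  have deriv_at {V : Type} [NormedAddCommGroup V] [NormedSpace ℝ V] {φ : ℝ → V}
      (hφ : ContDiff ℝ (⊤ : ℕ∞) φ) (s : ℝ) : HasDerivAt φ (deriv φ s) s :=
    (hφ.differentiable (by simp) s).hasDerivAt
  have hT_at (s : ℝ) : HasDerivAt T (κ s • N s) s := hT' s ▸ deriv_at hT s
  have hN_at (s : ℝ) : HasDerivAt N ((-κ s) • T s + τ s • B s) s := hN' s ▸ deriv_at hN s
  have hB_at (s : ℝ) : HasDerivAt B ((-τ s) • N s) s := hB' s ▸ deriv_at hB s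
  have hα_at (s : ℝ) : HasDerivAt α (T s) s := hTα s ▸ deriv_at hα s
  have inner_eq (s : ℝ) := inner_combination_of_orthonormal (hT1 s) (hN1 s) (hB1 s) (hTN s) (hTB s)
    (hNB s)
  set y := deriv r with hy_def
  set z := deriv y with hz_def
  have hy : ContDiff ℝ (⊤ : ℕ∞) y := hr.deriv'
  have hz : ContDiff ℝ (⊤ : ℕ∞) z := hy.deriv'
  have hy1 (s : ℝ) : 0 < 1 - y s ^ 2 := by
    have := (sq_lt_one_iff_abs_lt_one (y s)).2 (hr1 s)
    linarith
  obtain ⟨q, hq⟩ : ∃ q : ℝ → ℝ, q = fun s => √(1 - y s ^ 2) := ⟨_, rfl⟩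
  have q_smooth : ContDiff ℝ (⊤ : ℕ∞) q :=
    hq ▸ (contDiff_const.sub (hy.pow 2)).sqrt fun s => (hy1 s).ne'
  have q_pos (s : ℝ) : 0 < q s := by simpa [hq] using hy1 s
  have q_sq (s : ℝ) : q s ^ 2 = 1 - y s ^ 2 := by simp [hq, Real.sq_sqrt (hy1 s).le]
  have q_deriv (s : ℝ) : q s * deriv q s = -(y s * z s) := by
    have h₁ := (deriv_at q_smooth s).pow 2
    have h₂ := ((deriv_at hy s).pow 2).const_sub 1
    have := h₁.unique (h₂.congr_of_eventuallyEq (.of_forall q_sq))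
    norm_num at this
    linarith
  obtain rfl : R = _ := funext hR
  have hQ (s : ℝ) : Q s = r s * q s := by rw [hQ, hq]
  obtain rfl : Q = _ := funext hQ
  have n_eq (s t : ℝ) : n s t = (-y s) • T s + (-(q s * Real.cos t)) • N s
      + (q s * Real.sin t) • B s := by
    rw [hn, hC]
    rw [inv_smul_eq_iff₀ (hrpos s).ne']
    module
  obtain ⟨m₂, hm₂⟩ : ∃ m : ℝ → ℝ → ℝ, m = fun s t => y s * κ s + deriv q s * Real.cos t
      + q s * τ s * Real.sin t := ⟨_, rfl⟩
  obtain ⟨m₃, hm₃⟩ : ∃ m : ℝ → ℝ → ℝ, m = fun s t => deriv q s * Real.sin t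
      - q s * τ s * Real.cos t := ⟨_, rfl⟩
  obtain ⟨x₁, hx₁⟩ : ∃ x : ℝ → ℝ → ℝ, x = fun s t => 1 - y s ^ 2
      + r s * (q s * κ s * Real.cos t - z s) := ⟨_, rfl⟩
  obtain ⟨x₂, hx₂⟩ : ∃ x : ℝ → ℝ → ℝ, x = fun s t => -(y s * q s * Real.cos t)
      - r s * m₂ s t := ⟨_, rfl⟩
  obtain ⟨x₃, hx₃⟩ : ∃ x : ℝ → ℝ → ℝ, x = fun s t => y s * q s * Real.sin t
      + r s * m₃ s t := ⟨_, rfl⟩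
  have Cs_eq (s t : ℝ) : Cs s t = x₁ s t • T s + x₂ s t • N s + x₃ s t • B s := by
    have hrq := (deriv_at hr s).mul (deriv_at q_smooth s)
    have h := (hα_at s).add ((hT_at s).combination_frenet (hN_at s) (hB_at s)
      ((deriv_at hr s).mul (deriv_at hy s)).neg (hrq.mul_const (Real.cos t)).neg
      (hrq.mul_const (Real.sin t)))
    rw [hCs]
    refine ((h.congr_of_eventuallyEq (.of_forall fun v => ?_)).congr_deriv ?_).deriv
    · simp only [hC, Pi.add_apply, Pi.neg_apply, Pi.mul_apply]
      module
    · simp only [hx₁, hx₂, hx₃, hm₂, hm₃, Pi.neg_apply, Pi.mul_apply]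
      module
  have Ct_eq (s t : ℝ) : Ct s t = (0 : ℝ) • T s + (r s * q s * Real.sin t) • N s
      + (r s * q s * Real.cos t) • B s := by
    have h := HasDerivAt.combination_const (T s) (N s) (B s)
      (hasDerivAt_const t (-(r s * y s))) ((Real.hasDerivAt_cos t).const_mul (-(r s * q s)))
      ((Real.hasDerivAt_sin t).const_mul (r s * q s))
    rw [hCt]
    refine (((h.const_add (α s)).congr_of_eventuallyEq (.of_forall fun v => ?_)).congr_deriv
      ?_).deriv
    · simp only [hC]
      module
    · module
  have Ctt_eq (s t : ℝ) : Ctt s t = (0 : ℝ) • T s + (r s * q s * Real.cos t) • N s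
      + (r s * q s * -Real.sin t) • B s := by
    rw [hCtt, funext (Ct_eq s)]
    exact (HasDerivAt.combination_const (T s) (N s) (B s) (hasDerivAt_const t 0)
      ((Real.hasDerivAt_sin t).const_mul _) ((Real.hasDerivAt_cos t).const_mul _)).deriv
  have Cst_eq (s t : ℝ) : Cst s t = (-(r s * (q s * κ s * Real.sin t))) • T s
      + (y s * q s * Real.sin t
        + r s * (deriv q s * Real.sin t - q s * τ s * Real.cos t)) • N s
      + (y s * q s * Real.cos t
        + r s * (deriv q s * Real.cos t + q s * τ s * Real.sin t)) • B s := by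
    have hcos := Real.hasDerivAt_cos t
    have hsin := Real.hasDerivAt_sin t
    have h := HasDerivAt.combination_const (T s) (N s) (B s)
      ((((hcos.const_mul (q s * κ s)).sub_const (z s)).const_mul (r s)).const_add (1 - y s ^ 2))
      ((hcos.const_mul (y s * q s)).neg.sub ((((hcos.const_mul (deriv q s)).const_add
        (y s * κ s)).add (hsin.const_mul (q s * τ s))).const_mul (r s)))
      ((hsin.const_mul (y s * q s)).add (((hsin.const_mul (deriv q s)).sub
        (hcos.const_mul (q s * τ s))).const_mul (r s)))
    rw [hCst, funext (Cs_eq s), hx₁, hx₂, hx₃, hm₂, hm₃]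
    refine (h.congr_deriv ?_).deriv
    module
  obtain ⟨u, hu⟩ : ∃ u : ℝ → ℝ, u = fun s => q s * κ s := ⟨_, rfl⟩
  have u_smooth : ContDiff ℝ (⊤ : ℕ∞) u := hu ▸ q_smooth.mul hκ
  have g_eq (s t : ℝ) : g s t = -(r s * (1 - y s ^ 2)) := by
    rw [hg, Ctt_eq, n_eq, inner_eq, ← q_sq]
    linear_combination (-(r s * q s ^ 2)) * Real.sin_sq_add_cos_sq t
  have f_eq (s t : ℝ) : f s t = r s * (1 - y s ^ 2)
      * (τ s + y s * u s / (1 - y s ^ 2) * Real.sin t) := by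
    have := (q_pos s).ne'
    rw [hf, Cst_eq, n_eq, inner_eq, ← q_sq, hu]
    field_simp
    linear_combination (r s * q s * τ s) * Real.sin_sq_add_cos_sq t
  have normal_deriv (s t : ℝ) : HasDerivAt (fun v => n v t)
      ((u s * Real.cos t - z s) • T s + (-m₂ s t) • N s + m₃ s t • B s) s := by
    have h := (hT_at s).combination_frenet (hN_at s) (hB_at s) (deriv_at hy s).neg
      ((deriv_at q_smooth s).mul_const (Real.cos t)).neg
      ((deriv_at q_smooth s).mul_const (Real.sin t))
    refine (h.congr_of_eventuallyEq (.of_forall fun v => n_eq v t)).congr_deriv ?_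
    simp only [hu, hm₂, hm₃, Pi.neg_apply]
    module
  have Css_at (s t : ℝ) : HasDerivAt (fun v => Cs v t) (Css s t) s := by
    have hy' := hy.differentiable (by simp) s
    have hz' := hz.differentiable (by simp) s
    have hr' := hr.differentiable (by simp) s
    have hκ' := hκ.differentiable (by simp) s
    have hτ' := hτ.differentiable (by simp) s
    have hq' := q_smooth.differentiable (by simp) s
    have dq_smooth : ContDiff ℝ (⊤ : ℕ∞) (deriv q) := q_smooth.deriv'
    have hdq' := dq_smooth.differentiable (by simp) s
    have h₁ : DifferentiableAt ℝ (fun v => x₁ v t) s := by simp only [hx₁]; fun_prop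
    have h₂ : DifferentiableAt ℝ (fun v => x₂ v t) s := by simp only [hx₂, hm₂]; fun_prop
    have h₃ : DifferentiableAt ℝ (fun v => x₃ v t) s := by simp only [hx₃, hm₃]; fun_prop
    have h := (hT_at s).combination_frenet (hN_at s) (hB_at s) h₁.hasDerivAt h₂.hasDerivAt
      h₃.hasDerivAt
    have h' := h.congr_of_eventuallyEq (.of_forall fun v => Cs_eq v t)
    rw [hCss]
    exact h'.differentiableAt.hasDerivAt
  have m_radial (s t : ℝ) : q s * (Real.cos t * m₂ s t + Real.sin t * m₃ s t)
      = y s * (u s * Real.cos t - z s) := by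
    simp only [hm₂, hm₃, hu]
    linear_combination q_deriv s + q s * deriv q s * Real.sin_sq_add_cos_sq t
  have m_angular (s t : ℝ) : Real.sin t * m₂ s t - Real.cos t * m₃ s t
      = y s * κ s * Real.sin t + q s * τ s := by
    simp only [hm₂, hm₃]
    linear_combination q s * τ s * Real.sin_sq_add_cos_sq t
  have m_sq (s t : ℝ) : q s ^ 2 * (m₂ s t ^ 2 + m₃ s t ^ 2)
      = y s ^ 2 * (u s * Real.cos t - z s) ^ 2
        + q s ^ 2 * (y s * κ s * Real.sin t + q s * τ s) ^ 2 := by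
    rw [← m_angular, ← mul_pow, ← m_radial]
    linear_combination (-(q s ^ 2 * (m₂ s t ^ 2 + m₃ s t ^ 2))) * Real.sin_sq_add_cos_sq t
  have Cs_inner_normal (s t : ℝ) : ⟪Cs s t, n s t⟫ = 0 := by
    rw [Cs_eq, n_eq, inner_eq]
    simp only [hx₁, hx₂, hx₃]
    have := m_radial s t
    rw [hu] at this
    linear_combination r s * this + y s * q s ^ 2 * Real.sin_sq_add_cos_sq t + y s * q_sq s
  have e_eq (s t : ℝ) : e s t = -(u s * Real.cos t - z s
      + r s / (1 - y s ^ 2) * (u s * Real.cos t - z s) ^ 2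
      + r s * (1 - y s ^ 2) * (τ s + y s * u s / (1 - y s ^ 2) * Real.sin t) ^ 2) := by
    have h := ((Css_at s t).inner ℝ (normal_deriv s t)).unique
      ((hasDerivAt_const s (0 : ℝ)).congr_of_eventuallyEq
        (.of_forall fun v => Cs_inner_normal v t))
    rw [← he, Cs_eq, inner_eq] at h
    have hq0 := (q_pos s).ne'
    have hu_s : u s = q s * κ s := by rw [hu]
    have h_sq := m_sq s t
    have h_rad := m_radial s t
    simp only [hx₁, hx₂, hx₃, ← hu_s] at h
    have h_p : q s * (τ s + y s * u s / (1 - y s ^ 2) * Real.sin t)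
        = y s * κ s * Real.sin t + q s * τ s := by
      rw [← q_sq, hu_s]
      field_simp
      ring
    have h_sq' : q s ^ 2 * (r s * (1 - y s ^ 2)
        * (τ s + y s * u s / (1 - y s ^ 2) * Real.sin t) ^ 2)
        = r s * q s ^ 2 * (y s * κ s * Real.sin t + q s * τ s) ^ 2 := by
      rw [← h_p, ← q_sq]
      ring
    have h_div : q s ^ 2 * (r s / (1 - y s ^ 2)) = r s := by
      rw [q_sq, mul_div_cancel₀ _ (hy1 s).ne']
    refine mul_left_cancel₀ (pow_ne_zero 2 hq0) ?_
    linear_combination q s ^ 2 * h - q s ^ 2 * y s * h_rad - r s * h_sq + h_sq'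
      + (u s * Real.cos t - z s) ^ 2 * h_div - r s * (u s * Real.cos t - z s) ^ 2 * q_sq s
  have disc_eq (s t : ℝ) : E s t * G s t - F s t ^ 2
      = r s ^ 2 * (1 - y s ^ 2 + r s * (u s * Real.cos t - z s)) ^ 2 := by
    have h_sq := m_sq s t
    have h_rad := m_radial s t
    have hq := q_sq s
    have hE' : q s ^ 2 * E s t = (1 - y s ^ 2 + r s * (u s * Real.cos t - z s)) ^ 2
        + r s ^ 2 * (q s ^ 2 * (y s * κ s * Real.sin t + q s * τ s) ^ 2) := by
      rw [hE, Cs_eq, inner_eq]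
      simp only [hx₁, hx₂, hx₃, hu] at h_sq h_rad ⊢
      linear_combination r s ^ 2 * h_sq + 2 * r s * y s * q s ^ 2 * h_rad
        + y s ^ 2 * q s ^ 4 * Real.sin_sq_add_cos_sq t
        + ((1 - y s ^ 2 + r s * (q s * κ s * Real.cos t - z s)) ^ 2
          + y s ^ 2 * (q s ^ 2 + (1 - y s ^ 2) + 2 * r s * (q s * κ s * Real.cos t - z s))) * hq
    have hF' : F s t = -(r s ^ 2 * q s * (y s * κ s * Real.sin t + q s * τ s)) := by
      rw [hF, Cs_eq, Ct_eq, inner_eq, ← m_angular]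
      simp only [hx₂, hx₃]
      ring
    have hG' : G s t = r s ^ 2 * q s ^ 2 := by
      rw [hG, Ct_eq, inner_eq]
      linear_combination r s ^ 2 * q s ^ 2 * Real.sin_sq_add_cos_sq t
    rw [hF', hG']
    linear_combination r s ^ 2 * hE'
  have disc₂_eq (s t : ℝ) : e s t * g s t - f s t ^ 2 = r s * (u s * Real.cos t - z s)
      * (1 - y s ^ 2 + r s * (u s * Real.cos t - z s)) := by
    have := (hy1 s).ne'
    rw [e_eq, f_eq, g_eq]
    field_simp
    ring
  intro s
  by_contra hκs
  have us : u s ≠ 0 := by simpa [hu, hκs] using (q_pos s).ne'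
  have num_add := brioschi_numerator_add_numerator_neg hr u_smooth hτ (fun s => (hrpos s).ne')
    (fun s => (hy1 s).ne') e_eq f_eq g_eq hes het hett hfs hft hfst hgs hgt hgss
    (fun _ _ => rfl) s
  have hr0 := (hrpos s).ne'
  have hQ0 := (hy1 s).ne'
  obtain ⟨P, hP⟩ : ∃ P, P = 1 - y s ^ 2 := ⟨_, rfl⟩
  obtain ⟨L, hL⟩ : ∃ L, L = P / (4 * r s) - P ^ 2 / (4 * r s) - P * z s + z s / 2 := ⟨_, rfl⟩
  have key := coeffs_eq_zero_of_forall_mem_Icc (z := z s)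
    (c₀ := -b * P * (P / 4 * (u s ^ 2 - z s ^ 2 - y s * deriv z s) - z s * L))
    (c₁ := -b * P * (P / 4 * (y s * deriv u s) + u s * L))
    (c₂ := -b * P ^ 2 / 4 - d * r s * P ^ 2)
    (c₃ := a * P - 3 / 2 * b * r s * P - 2 * d * r s ^ 2 * P)
    (c₄ := a * r s - b * r s ^ 2 - d * r s ^ 3) us ?_
  · obtain ⟨h₂, h₃, h₄⟩ := key
    refine hb ?_
    have : P ^ 2 * r s ^ 2 * b = 0 := by
      linear_combination 4 * r s ^ 2 * h₂ - 4 * P * (r s * h₃ - P * h₄)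
    simpa [hP, hQ0, hr0] using this
  · intro x hx
    obtain ⟨t, rfl⟩ : ∃ t, Real.cos t = x := ⟨_, Real.cos_arccos hx.1 hx.2⟩
    have h₁ := hlin s t
    have h₂ := hlin s (-t)
    have ht := num_add t _ P rfl hP
    have h₄ := hreg2 s t
    rw [hK, hKII, disc_eq, disc₂_eq] at h₁ h₂
    rw [disc₂_eq] at h₄
    rw [Real.cos_neg] at h₂
    simp only [← hP, ← hy_def, ← hz_def] at h₁ h₂ h₄ ht
    have clear_denominators {A W ν : ℝ} (h0 : r s * A * W ≠ 0)
        (h : a * (r s * A * W / (r s ^ 2 * W ^ 2)) + b * ((r s * A * W)⁻¹ ^ 2 * ν) = d) :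
        a * r s * A ^ 3 * W + b * ν = d * (r s * A * W) ^ 2 := by
      obtain ⟨⟨-, hA⟩, hW⟩ : (r s ≠ 0 ∧ A ≠ 0) ∧ W ≠ 0 := by simpa [not_or] using h0
      rw [← h]
      field_simp
    have h₅ := clear_denominators h₄ h₁
    have h₆ := clear_denominators h₄ h₂
    have hρ : r s ^ 2 / P * P = r s ^ 2 := div_mul_cancel₀ _ (hP ▸ hQ0)
    rw [← hL] at ht
    refine mul_left_cancel₀ hr0 ?_
    linear_combination (h₅ + h₆ - b * ht) / 2 + b * r s * (u s * Real.cos t - z s) ^ 4 * hρ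
end
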